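/- Let G be the subgroup of SL(2, ℤ[i]) generated by the four matrices [[1,1],[0,1]], [[1,i],[0,1]], [[0,-1],[1,0]], and [[i,0],[0,-i]], and let F = {x₀ + x₁·i + y·j : -1/2 < x₀ < 1/2, 0 < x₁ < 1/2, x₀² + x₁² + y² > 1, y > 0}. If z ∈ F and γ ∈ G are such that γ·z ∈ F, then γ·z = z; i.e., the open fundamental domain F meets each orbit of G at most once. -/

import Mathlib

open GaussianInt Quaternion

/-- Embedding of a complex number `x = x₀ + x₁·i` into the real quaternions. -/
noncomputable def toQ (x : ℂ) : Quaternion ℝ := ⟨x.re, x.im, 0, 0⟩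

/-- The linear fractional transformation `z ↦ (az+b)(cz+d)⁻¹` of a quaternion,
for `γ = [[a,b],[c,d]] ∈ SL(2,ℂ)`, computed in the quaternions. -/
noncomputable def lft (γ : Matrix.SpecialLinearGroup (Fin 2) ℂ) (z : Quaternion ℝ) :
    Quaternion ℝ :=
  (toQ (γ.1 0 0) * z + toQ (γ.1 0 1)) * (toQ (γ.1 1 0) * z + toQ (γ.1 1 1))⁻¹

/-- The translation matrix `[[1,1],[0,1]]` in `SL(2,ℤ[i])`. -/
def matT : Matrix.SpecialLinearGroup (Fin 2) GaussianInt :=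
  ⟨!![1, 1; 0, 1], by simp [Matrix.det_fin_two_of]⟩

/-- The translation matrix `[[1,i],[0,1]]` in `SL(2,ℤ[i])`. -/
def matTi : Matrix.SpecialLinearGroup (Fin 2) GaussianInt :=
  ⟨!![1, ⟨0, 1⟩; 0, 1], by simp [Matrix.det_fin_two_of]⟩

/-- The inversion matrix `[[0,-1],[1,0]]` in `SL(2,ℤ[i])`. -/
def matS : Matrix.SpecialLinearGroup (Fin 2) GaussianInt :=
  ⟨!![0, -1; 1, 0], by norm_num [Matrix.det_fin_two_of]⟩

/-- The matrix `[[i,0],[0,-i]]` in `SL(2,ℤ[i])`. -/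
def matE : Matrix.SpecialLinearGroup (Fin 2) GaussianInt :=
  ⟨!![⟨0, 1⟩, 0; 0, -⟨0, 1⟩], by simp [Matrix.det_fin_two_of]; decide⟩

/-- The subgroup of `SL(2,ℤ[i])` generated by the four matrices `[[1,1],[0,1]]`,
`[[1,i],[0,1]]`, `[[0,-1],[1,0]]` and `[[i,0],[0,-i]]`. -/
def picardGen : Subgroup (Matrix.SpecialLinearGroup (Fin 2) GaussianInt) :=
  Subgroup.closure {matT, matTi, matS, matE}

/-- The open fundamental domain
`F = {x₀ + x₁·i + y·j : -1/2 < x₀ < 1/2, 0 < x₁ < 1/2, x₀² + x₁² + y² > 1, y > 0}`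
of the Picard group, as a set of quaternions. -/
def picardF : Set (Quaternion ℝ) :=
  {q | -(1/2) < q.re ∧ q.re < 1/2 ∧ 0 < q.imI ∧ q.imI < 1/2 ∧
    1 < q.re ^ 2 + q.imI ^ 2 + q.imJ ^ 2 ∧ 0 < q.imJ ∧ q.imK = 0}

@[simp] lemma toQ_re (x : ℂ) : (toQ x).re = x.re := rfl

@[simp] lemma toQ_imI (x : ℂ) : (toQ x).imI = x.im := rfl

@[simp] lemma toQ_imJ (x : ℂ) : (toQ x).imJ = 0 := rfl

@[simp] lemma toQ_imK (x : ℂ) : (toQ x).imK = 0 := rfl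

/-- An integer translation does not decrease the square of a real number in `(-1/2, 1/2)`. -/
lemma sq_le_sq_add_intCast {x : ℝ} (h₁ : -(1/2) < x) (h₂ : x < 1/2) (n : ℤ) :
    x ^ 2 ≤ (x + n) ^ 2 := by
  rcases lt_trichotomy n 0 with hn | rfl | hn
  · have : (n : ℝ) ≤ -1 := by exact_mod_cast (by lia : n ≤ -1)
    nlinarith
  · simp
  · have : (1 : ℝ) ≤ n := by exact_mod_cast hn
    nlinarith

/-- The squared norm of `cz + d` for `z` in the upper half-space. -/
lemma normSq_toQ_mul_add_toQ (c d : ℂ) (z : Quaternion ℝ) (hz : z.imK = 0) :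
    normSq (toQ c * z + toQ d) =
      (c.re * z.re - c.im * z.imI + d.re) ^ 2 + (c.re * z.imI + c.im * z.re + d.im) ^ 2
        + (c.re ^ 2 + c.im ^ 2) * z.imJ ^ 2 := by
  simp [Quaternion.normSq_def', hz]
  ring

lemma half_lt_imJ_sq_of_mem_picardF {z : Quaternion ℝ} (hz : z ∈ picardF) :
    1 / 2 < z.imJ ^ 2 := by
  obtain ⟨h₁, h₂, h₃, h₄, h₅, -, -⟩ := hz
  nlinarith

/-- A Gaussian integer of norm one is one of the four units `1, -1, i, -i`. -/
lemma eq_unit_of_sq_add_sq_eq_one {m n : ℤ} (h : m ^ 2 + n ^ 2 = 1) :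
    (m = 1 ∧ n = 0) ∨ (m = -1 ∧ n = 0) ∨ (m = 0 ∧ n = 1) ∨ (m = 0 ∧ n = -1) := by
  have hm : m ≤ 1 := by nlinarith
  have hm' : -1 ≤ m := by nlinarith
  have hn : n ≤ 1 := by nlinarith
  have hn' : -1 ≤ n := by nlinarith
  interval_cases m <;> interval_cases n <;> simp_all

lemma one_lt_normSq_of_two_le_norm {z : Quaternion ℝ} (hz : z ∈ picardF) {c : GaussianInt}
    (hc : 2 ≤ c.re ^ 2 + c.im ^ 2) (d : GaussianInt) : 1 < normSq (toQ c * z + toQ d) := by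
  have hc' : (2 : ℝ) ≤ (c.re : ℝ) ^ 2 + (c.im : ℝ) ^ 2 := by exact_mod_cast hc
  have hy := half_lt_imJ_sq_of_mem_picardF hz
  rw [normSq_toQ_mul_add_toQ _ _ _ hz.2.2.2.2.2.2]
  simp only [← GaussianInt.intCast_re, ← GaussianInt.intCast_im]
  nlinarith [sq_nonneg ((c.re : ℝ) * z.re - c.im * z.imI + d.re),
    sq_nonneg ((c.re : ℝ) * z.imI + c.im * z.re + d.im)]

/-- Points of the fundamental domain lie outside every unit sphere centred at a Gaussian integer. -/
lemma one_lt_normSq_of_norm_eq_one {z : Quaternion ℝ} (hz : z ∈ picardF) {c : GaussianInt}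
    (hc : c.re ^ 2 + c.im ^ 2 = 1) (d : GaussianInt) : 1 < normSq (toQ c * z + toQ d) := by
  rw [normSq_toQ_mul_add_toQ _ _ _ hz.2.2.2.2.2.2]
  obtain ⟨h₁, h₂, h₃, h₄, h₅, -, -⟩ := hz
  have re_le := sq_le_sq_add_intCast h₁ h₂
  have im_le := sq_le_sq_add_intCast (by linarith : -(1/2) < z.imI) h₄
  simp only [← GaussianInt.intCast_re, ← GaussianInt.intCast_im]
  rcases eq_unit_of_sq_add_sq_eq_one hc with ⟨hr, hi⟩ | ⟨hr, hi⟩ | ⟨hr, hi⟩ | ⟨hr, hi⟩ <;>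
    simp only [hr, hi] <;> push_cast
  · nlinarith [re_le d.re, im_le d.im]
  · have hre := re_le (-d.re)
    have him := im_le (-d.im)
    push_cast at hre him
    nlinarith
  · have him := im_le (-d.re)
    push_cast at him
    nlinarith [re_le d.im]
  · have hre := re_le (-d.im)
    push_cast at hre
    nlinarith [im_le d.re]

lemma toQ_mul (a b : ℂ) : toQ (a * b) = toQ a * toQ b := by
  ext <;> simp

lemma toQ_sub (a b : ℂ) : toQ (a - b) = toQ a - toQ b := by
  ext <;> simp

lemma toQ_neg (a : ℂ) : toQ (-a) = -toQ a := by
  ext <;> simp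

lemma toQ_one : toQ 1 = 1 := by
  ext <;> simp

/-- If `w = (az + b)(cz + d)⁻¹` with `ad - bc = 1`, then `-cw + a` is inverse to `cz + d`. -/
lemma neg_mul_add_mul_denom_eq_one {a b c d : ℂ} (hdet : a * d - b * c = 1)
    {z : Quaternion ℝ} (hden : toQ c * z + toQ d ≠ 0) :
    (toQ (-c) * ((toQ a * z + toQ b) * (toQ c * z + toQ d)⁻¹) + toQ a) *
      (toQ c * z + toQ d) = 1 := by
  have hcomm : toQ c * toQ a = toQ a * toQ c := by rw [← toQ_mul, mul_comm, toQ_mul]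
  have hdet' : toQ a * toQ d - toQ c * toQ b = 1 := by
    rw [← toQ_mul, ← toQ_mul, ← toQ_sub, mul_comm c, hdet, toQ_one]
  rw [add_mul, mul_assoc (toQ (-c)), mul_assoc (toQ a * z + toQ b), inv_mul_cancel₀ hden,
    mul_one, toQ_neg, neg_mul, mul_add, mul_add, ← mul_assoc, ← mul_assoc, hcomm, ← hdet']
  abel

/-- Two real numbers in a common open unit interval with integer difference are equal. -/
lemma eq_of_eq_add_intCast {x w : ℝ} {n : ℤ} (h : w = x + n) (h₁ : w - x < 1)
    (h₂ : x - w < 1) : w = x := by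
  have hn₁ : n < 1 := by exact_mod_cast (by linarith : (n : ℝ) < 1)
  have hn₂ : -1 < n := by exact_mod_cast (by push_cast; linarith : ((-1 : ℤ) : ℝ) < n)
  obtain rfl : n = 0 := by lia
  simpa using h

/-- Two points of the fundamental domain related by an upper triangular element of
`SL(2, ℤ[i])` coincide. -/
lemma eq_of_mul_eq_of_mem_picardF {z w : Quaternion ℝ} (hz : z ∈ picardF) (hw : w ∈ picardF)
    {a b d : GaussianInt} (had : a * d = 1) (h : w * toQ d = toQ a * z + toQ b) : w = z := by
  obtain ⟨z₁, z₂, z₃, z₄, -, -, z₅⟩ := hz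
  obtain ⟨w₁, w₂, w₃, w₄, -, -, w₅⟩ := hw
  have hre : a.re * d.re - a.im * d.im = 1 := by
    have := congrArg Zsqrtd.re had
    simp at this
    lia
  have him : a.re * d.im + a.im * d.re = 0 := by
    have := congrArg Zsqrtd.im had
    simpa using this
  have hnorm : a.re ^ 2 + a.im ^ 2 = 1 := by
    have hmul : (a.re ^ 2 + a.im ^ 2) * (d.re ^ 2 + d.im ^ 2) = 1 := by
      linear_combination (a.re * d.re - a.im * d.im + 1) * hre +
        (a.re * d.im + a.im * d.re) * him
    exact Int.eq_one_of_mul_eq_one_right (by positivity) hmul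
  have e₀ := congrArg (fun q : Quaternion ℝ => q.re) h
  have e₁ := congrArg (fun q : Quaternion ℝ => q.imI) h
  have e₂ := congrArg (fun q : Quaternion ℝ => q.imJ) h
  simp [z₅, w₅] at e₀ e₁ e₂
  simp only [← GaussianInt.intCast_re, ← GaussianInt.intCast_im] at e₀ e₁ e₂
  rcases eq_unit_of_sq_add_sq_eq_one hnorm with ⟨hr, hi⟩ | ⟨hr, hi⟩ | ⟨hr, hi⟩ | ⟨hr, hi⟩ <;>
    simp only [hr, hi] at hre him e₀ e₁ e₂
  · have hd : d.re = 1 := by lia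
    have hd' : d.im = 0 := by lia
    simp [hd, hd', -GaussianInt.intCast_re, -GaussianInt.intCast_im] at e₀ e₁ e₂
    have f₀ := eq_of_eq_add_intCast e₀ (by linarith) (by linarith)
    have f₁ := eq_of_eq_add_intCast e₁ (by linarith) (by linarith)
    exact Quaternion.ext _ _ f₀ f₁ e₂ (w₅.trans z₅.symm)
  · have hd : d.re = -1 := by lia
    have hd' : d.im = 0 := by lia
    simp [hd, hd', -GaussianInt.intCast_re, -GaussianInt.intCast_im] at e₀ e₁ e₂
    have f₀ := eq_of_eq_add_intCast (n := -b.re) (x := z.re) (w := w.re)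
      (by push_cast; linarith) (by linarith) (by linarith)
    have f₁ := eq_of_eq_add_intCast (n := -b.im) (x := z.imI) (w := w.imI)
      (by push_cast; linarith) (by linarith) (by linarith)
    exact Quaternion.ext _ _ f₀ f₁ e₂ (w₅.trans z₅.symm)
  · have hd : d.re = 0 := by lia
    have hd' : d.im = -1 := by lia
    simp [hd, hd', -GaussianInt.intCast_re, -GaussianInt.intCast_im] at e₀
    have hb₁ : (0 : ℝ) < b.re := by linarith
    have hb₂ : (b.re : ℝ) < 1 := by linarith
    norm_cast at hb₁ hb₂
    lia
  · have hd : d.re = 0 := by lia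
    have hd' : d.im = 1 := by lia
    simp [hd, hd', -GaussianInt.intCast_re, -GaussianInt.intCast_im] at e₀
    have hb₁ : (-1 : ℝ) < b.re := by linarith
    have hb₂ : (b.re : ℝ) < 0 := by linarith
    have hb₁' : -1 < b.re := by exact_mod_cast hb₁
    norm_cast at hb₂
    lia

/-- The open fundamental domain `F` meets each orbit of the group generated by
`[[1,1],[0,1]]`, `[[1,i],[0,1]]`, `[[0,-1],[1,0]]` and `[[i,0],[0,-i]]` at most
once: if `z ∈ F`, `γ` is in the group, and `γ·z ∈ F`, then `γ·z = z`. -/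
theorem fundamental_domain_meets_orbit_at_most_once
    (z : Quaternion ℝ) (hz : z ∈ picardF)
    (γ : Matrix.SpecialLinearGroup (Fin 2) GaussianInt) (hγ : γ ∈ picardGen)
    (hγz : lft (Matrix.SpecialLinearGroup.map (GaussianInt.toComplex) γ) z ∈ picardF) :
    lft (Matrix.SpecialLinearGroup.map (GaussianInt.toComplex) γ) z = z := by
  set w := lft (Matrix.SpecialLinearGroup.map (GaussianInt.toComplex) γ) z with hw
  have hdetγ : γ.1 0 0 * γ.1 1 1 - γ.1 0 1 * γ.1 1 0 = 1 := by
    rw [← Matrix.det_fin_two]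
    exact γ.2
  generalize ha : γ.1 0 0 = a at hdetγ
  generalize hb : γ.1 0 1 = b at hdetγ
  generalize hc : γ.1 1 0 = c at hdetγ
  generalize hd : γ.1 1 1 = d at hdetγ
  have hw' : w = (toQ a * z + toQ b) * (toQ c * z + toQ d)⁻¹ := by
    rw [hw, ← ha, ← hb, ← hc, ← hd]
    rfl
  have hden : toQ c * z + toQ d ≠ 0 := by
    intro h
    have hpos := hγz.2.2.2.2.2.1
    simp [hw', h] at hpos
  have hdet : (a : ℂ) * d - b * c = 1 := by
    simpa using congrArg toComplex hdetγ
  have hinv := neg_mul_add_mul_denom_eq_one hdet hden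
  rw [← hw', ← toComplex_neg] at hinv
  have hprod := congrArg normSq hinv
  rw [map_mul, map_one] at hprod
  have hnonneg : 0 ≤ c.re ^ 2 + c.im ^ 2 := by positivity
  obtain hzero | hone | htwo : c.re ^ 2 + c.im ^ 2 = 0 ∨ c.re ^ 2 + c.im ^ 2 = 1 ∨
      2 ≤ c.re ^ 2 + c.im ^ 2 := by lia
  · have hc0 : c = 0 := by
      ext <;> simp <;> nlinarith
    subst hc0
    refine eq_of_mul_eq_of_mem_picardF hz hγz (a := a) (b := b) (d := d) (by simpa using hdetγ) ?_
    have hmul : w * (toQ (0 : GaussianInt) * z + toQ d) = toQ a * z + toQ b := by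
      rw [hw', mul_assoc, inv_mul_cancel₀ hden, mul_one]
    have h0 : toQ 0 = 0 := by ext <;> simp
    simpa [h0] using hmul
  · have hz_lt := one_lt_normSq_of_norm_eq_one hz hone d
    have hw_lt := one_lt_normSq_of_norm_eq_one hγz (c := -c) (by simpa using hone) a
    nlinarith
  · have hz_lt := one_lt_normSq_of_two_le_norm hz htwo d
    have hw_lt := one_lt_normSq_of_two_le_norm hγz (c := -c) (by simpa using htwo) a
    nlinarith
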